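/- arXiv:2006.00020 — 3 statements merged into one kernel-verified Lean document; each statement's English description precedes it below -/
import Mathlib

section
/- Let f : ℝ → ℝ and let p q : ℝ with p < q and f p ≠ f q. Then there exist sequences u v : ℕ → ℝ with u 0 = p, v 0 = q, u monotone nondecreasing, v monotone nonincreasing, and for every n: u n < v n, v n - u n = (q - p) / 2^n, and f (u n) ≠ f (v n). Moreover there exists d ∈ Icc p q such that u tends to d and v tends to d (in the topology of ℝ, as n → ∞). -/
open Classical in
/-- The half of the interval `[x.1, x.2]` kept by bisection: the left half if `f` takes distinct
values at its endpoints, and the right half otherwise. -/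
noncomputable def bisectionStep (f : ℝ → ℝ) (x : ℝ × ℝ) : ℝ × ℝ :=
  if f x.1 ≠ f ((x.1 + x.2) / 2) then (x.1, (x.1 + x.2) / 2) else ((x.1 + x.2) / 2, x.2)

theorem bisectionStep_sub (f : ℝ → ℝ) (x : ℝ × ℝ) :
    (bisectionStep f x).2 - (bisectionStep f x).1 = (x.2 - x.1) / 2 := by
  unfold bisectionStep
  split_ifs <;> ring

theorem le_bisectionStep_fst (f : ℝ → ℝ) {x : ℝ × ℝ} (hx : x.1 ≤ x.2) :
    x.1 ≤ (bisectionStep f x).1 := by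
  unfold bisectionStep
  split_ifs <;> dsimp only <;> linarith

theorem bisectionStep_snd_le (f : ℝ → ℝ) {x : ℝ × ℝ} (hx : x.1 ≤ x.2) :
    (bisectionStep f x).2 ≤ x.2 := by
  unfold bisectionStep
  split_ifs <;> dsimp only <;> linarith

theorem bisectionStep_ne (f : ℝ → ℝ) {x : ℝ × ℝ} (hx : f x.1 ≠ f x.2) :
    f (bisectionStep f x).1 ≠ f (bisectionStep f x).2 := by
  unfold bisectionStep
  split_ifs with h
  · exact h
  · rwa [← not_not.mp h]

theorem bisection_distinct_values (f : ℝ → ℝ) (p q : ℝ) (hpq : p < q) (hf : f p ≠ f q) :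
    ∃ u v : ℕ → ℝ, u 0 = p ∧ v 0 = q ∧ Monotone u ∧ Antitone v ∧
      (∀ n, u n < v n) ∧ (∀ n, v n - u n = (q - p) / 2 ^ n) ∧
      (∀ n, f (u n) ≠ f (v n)) ∧
      ∃ d ∈ Set.Icc p q, Filter.Tendsto u Filter.atTop (nhds d) ∧
        Filter.Tendsto v Filter.atTop (nhds d) := by
  let x : ℕ → ℝ × ℝ := fun n => (bisectionStep f)^[n] (p, q)
  have hsucc (n : ℕ) : x (n + 1) = bisectionStep f (x n) := Function.iterate_succ_apply' _ _ _
  have hlen (n : ℕ) : (x n).2 - (x n).1 = (q - p) / 2 ^ n := by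
    induction n with
    | zero => simp [x]
    | succ n ih => rw [hsucc, bisectionStep_sub, ih, pow_succ, div_div]
  have hlt (n : ℕ) : (x n).1 < (x n).2 := by
    have h : 0 < (q - p) / 2 ^ n := div_pos (sub_pos.mpr hpq) (by positivity)
    linarith [hlen n]
  have hne (n : ℕ) : f (x n).1 ≠ f (x n).2 := by
    induction n with
    | zero => exact hf
    | succ n ih => rw [hsucc]; exact bisectionStep_ne f ih
  have hu : Monotone fun n => (x n).1 := monotone_nat_of_le_succ fun n => by
    rw [hsucc]; exact le_bisectionStep_fst f (hlt n).le
  have hv : Antitone fun n => (x n).2 := antitone_nat_of_succ_le fun n => by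
    rw [hsucc]; exact bisectionStep_snd_le f (hlt n).le
  have hle (n : ℕ) : (x n).1 ≤ q := (hlt n).le.trans (hv n.zero_le)
  have hlim := tendsto_atTop_ciSup hu ⟨q, Set.forall_mem_range.mpr hle⟩
  have hzero : Filter.Tendsto (fun n : ℕ => (q - p) / 2 ^ n) Filter.atTop (nhds 0) :=
    tendsto_const_nhds.div_atTop (tendsto_pow_atTop_atTop_of_one_lt one_lt_two)
  refine ⟨fun n => (x n).1, fun n => (x n).2, rfl, rfl, hu, hv, hlt, hlen, hne, _,
    ⟨ge_of_tendsto' hlim fun n => hu n.zero_le, le_of_tendsto' hlim hle⟩, hlim, ?_⟩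
  simpa [← hlen] using hlim.add hzero
end

section
/- Let a b : ℝ with a ≤ b. Let U V : ℕ → ℚ × ℚ be computable functions and define A := ⋃ n, Ioo ((U n).1 : ℝ) ((U n).2 : ℝ) and B := ⋃ n, Ioo ((V n).1 : ℝ) ((V n).2 : ℝ). Suppose every rational r with (r : ℝ) ∈ Icc a b lies in A ∪ B but not in A ∩ B. Then there is a partial computable function g : ℚ →. Bool (Partrec in Mathlib's sense) such that for every rational r with (r : ℝ) ∈ Icc a b, g r is defined and g r = some true if and only if (r : ℝ) ∈ A. -/
theorem PrimrecRel.nat_coprime : PrimrecRel Nat.Coprime := by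
  have hdvd : PrimrecRel fun x n : ℕ => n % x = 0 :=
    Primrec.eq.comp (Primrec.nat_mod.comp Primrec.snd Primrec.fst) (Primrec.const 0)
  have hdiv : PrimrecRel fun (x : ℕ) (p : ℕ × ℕ) => p.1 % x = 0 ∧ p.2 % x = 0 → x = 1 :=
    (((hdvd.comp Primrec.fst (Primrec.fst.comp Primrec.snd)).and
      (hdvd.comp Primrec.fst (Primrec.snd.comp Primrec.snd))).not.or
        (Primrec.eq.comp Primrec.fst (Primrec.const 1))).of_eq fun _ => imp_iff_not_or.symm
  refine PrimrecPred.of_eq (hdiv.forall_mem_list.comp (Primrec.list_range.comp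
    (Primrec.succ.comp (Primrec.nat_add.comp Primrec.fst Primrec.snd))) Primrec.id) ?_
  rintro ⟨m, n⟩
  simp only [List.mem_range, ← Nat.dvd_iff_mod_eq_zero, id]
  refine ⟨fun h => h _ ?_ ⟨Nat.gcd_dvd_left m n, Nat.gcd_dvd_right m n⟩,
    fun h x _ hx => Nat.eq_one_of_dvd_coprimes h hx.1 hx.2⟩
  rcases Nat.eq_zero_or_pos m with rfl | hm
  · simp
  · exact (Nat.gcd_le_left n hm).trans_lt (by lia)

theorem PrimrecPred.nat_count {p : ℕ → Prop} [DecidablePred p] (hp : PrimrecPred p) :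
    Primrec (Nat.count p) :=
  (Primrec.nat_rec₁ 0 (Primrec.nat_add.comp Primrec.snd
    (Primrec.ite (hp.comp Primrec.fst) (Primrec.const 1) (Primrec.const 0))).to₂).of_eq
    fun n => by induction n with
      | zero => simp
      | succ n ih => rw [Nat.count_succ, ← ih]

open Encodable

theorem Denumerable.encode_ofEncodableOfInfinite {α : Type*} [Encodable α] [Infinite α]
    [DecidablePred (· ∈ Set.range (encode : α → ℕ))] (a : α) :
    @encode α (Denumerable.ofEncodableOfInfinite α).toEncodable a =
      Nat.count (· ∈ Set.range (encode : α → ℕ)) (encode a) := by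
  have h : @encode α (Denumerable.ofEncodableOfInfinite α).toEncodable a =
      @Nat.count (· ∈ Set.range (encode : α → ℕ)) (decidableRangeEncode α) (encode a) := rfl
  rw [h]
  congr!

/-- If the range of `f : α → ℕ` is primitive recursive and elements of `α` are encoded by their
rank with respect to `f`, then `f` is computable. -/
theorem Computable.of_encode_eq_count {α : Type*} [Primcodable α] {f : α → ℕ}
    [DecidablePred (· ∈ Set.range f)] (hf : PrimrecPred (· ∈ Set.range f))
    (h : ∀ a, encode a = Nat.count (· ∈ Set.range f) (f a)) : Computable f := by
  classical
  have hc : PrimrecRel fun (a : α) (c : ℕ) => c ∈ Set.range f ∧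
      Nat.count (· ∈ Set.range f) c = encode a :=
    (hf.comp Primrec.snd).and
      (Primrec.eq.comp (hf.nat_count.comp Primrec.snd) (Primrec.encode.comp Primrec.fst))
  refine (Partrec.rfind hc.decide.to_comp.partrec.to₂).of_eq fun a => ?_
  refine Part.eq_some_iff.2 (Nat.mem_rfind.2 ⟨?_, fun {m} hm => ?_⟩)
  · simp [h a]
  · have : ¬ (m ∈ Set.range f ∧ Nat.count (· ∈ Set.range f) m = encode a) := by
      rintro ⟨hm', he⟩
      rw [h] at he
      exact hm.ne (Nat.count_injective hm' (Set.mem_range_self a) he)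
    simpa using this

namespace Int

theorem encode_natCast (n : ℕ) : encode (n : ℤ) = 2 * n := rfl

theorem encode_negSucc (n : ℕ) : encode (Int.negSucc n) = 2 * n + 1 := rfl

theorem primrec_toNat : Primrec Int.toNat := by
  refine (Primrec.ite (c := fun z : ℤ => encode z % 2 = 0)
    (Primrec.eq.comp (Primrec.nat_mod.comp Primrec.encode (Primrec.const 2)) (Primrec.const 0))
    (Primrec.nat_div.comp Primrec.encode (Primrec.const 2)) (Primrec.const 0)).of_eq ?_
  rintro (n | n)
  · have := encode_natCast n
    simp_all
  · have := encode_negSucc n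
    simp_all [Nat.add_mod]

theorem primrec_toNat_neg : Primrec fun z : ℤ => (-z).toNat := by
  refine (Primrec.ite (c := fun z : ℤ => encode z % 2 = 0)
    (Primrec.eq.comp (Primrec.nat_mod.comp Primrec.encode (Primrec.const 2)) (Primrec.const 0))
    (Primrec.const 0) (Primrec.succ.comp
      (Primrec.nat_div.comp Primrec.encode (Primrec.const 2)))).of_eq ?_
  rintro (n | n)
  · have := encode_natCast n
    simp_all
  · have := encode_negSucc n
    simp_all [Nat.add_mod]
    lia

theorem primrec_natAbs : Primrec Int.natAbs :=
  (Primrec.nat_add.comp primrec_toNat primrec_toNat_neg).of_eq fun z => by lia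

end Int

namespace Rat

/-- The pairing of the codes of the numerator and of the denominator of a rational number. -/
def pairCode (q : ℚ) : ℕ :=
  Nat.pair (encode q.num) q.den

theorem mem_range_pairCode (c : ℕ) : c ∈ Set.range pairCode ↔
    0 < c.unpair.2 ∧ (Denumerable.ofNat ℤ c.unpair.1).natAbs.Coprime c.unpair.2 := by
  constructor
  · rintro ⟨q, rfl⟩
    simp only [pairCode, Nat.unpair_pair, Denumerable.ofNat_encode]
    exact ⟨q.den_pos, q.reduced⟩
  · rintro ⟨hpos, hcop⟩
    refine ⟨⟨Denumerable.ofNat ℤ c.unpair.1, c.unpair.2, hpos.ne', hcop⟩, ?_⟩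
    simp only [pairCode, Denumerable.encode_ofNat, Nat.pair_unpair]

theorem primrecPred_range_pairCode : PrimrecPred (· ∈ Set.range pairCode) := by
  have hden : Primrec fun c : ℕ => c.unpair.2 := Primrec.snd.comp Primrec.unpair
  have hnum : Primrec fun c : ℕ => Denumerable.ofNat ℤ c.unpair.1 :=
    (Primrec.ofNat ℤ).comp (Primrec.fst.comp Primrec.unpair)
  exact ((Primrec.nat_lt.comp (Primrec.const 0) hden).and
    (PrimrecRel.nat_coprime.comp (Int.primrec_natAbs.comp hnum) hden)).of_eq
      fun c => (mem_range_pairCode c).symm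

theorem computable_pairCode : Computable pairCode := by
  classical
  exact Computable.of_encode_eq_count primrecPred_range_pairCode
    (Denumerable.encode_ofEncodableOfInfinite (α := ℚ))

theorem computable_num : Computable Rat.num :=
  (((Primrec.ofNat ℤ).comp (Primrec.fst.comp Primrec.unpair)).to_comp.comp
    computable_pairCode).of_eq fun q => by
      simp only [pairCode, Nat.unpair_pair, Denumerable.ofNat_encode]

theorem computable_den : Computable Rat.den :=
  ((Primrec.snd.comp Primrec.unpair).to_comp.comp computable_pairCode).of_eq
    fun q => by simp [pairCode]

theorem lt_iff_toNat_lt (p q : ℚ) : p < q ↔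
    p.num.toNat * q.den + (-q.num).toNat * p.den <
      q.num.toNat * p.den + (-p.num).toNat * q.den := by
  have hp := Int.toNat_sub_toNat_neg p.num
  have hq := Int.toNat_sub_toNat_neg q.num
  rw [Rat.lt_iff, ← Nat.cast_lt (α := ℤ)]
  nth_rw 1 [← hp, ← hq]
  push_cast
  constructor <;> intro h <;> linarith

theorem computable_lt : Computable₂ fun p q : ℚ => decide (p < q) := by
  have hmul {f g : ℚ × ℚ → ℕ} (hf : Computable f) (hg : Computable g) :
      Computable fun x => f x * g x := Primrec.nat_mul.to_comp.comp hf hg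
  have hpos := Int.primrec_toNat.to_comp.comp computable_num
  have hneg := Int.primrec_toNat_neg.to_comp.comp computable_num
  have hfst {f : ℚ → ℕ} (hf : Computable f) : Computable fun x : ℚ × ℚ => f x.1 :=
    hf.comp Computable.fst
  have hsnd {f : ℚ → ℕ} (hf : Computable f) : Computable fun x : ℚ × ℚ => f x.2 :=
    hf.comp Computable.snd
  refine Computable.of_eq (Primrec.nat_lt.decide.to_comp.comp
    (Primrec.nat_add.to_comp.comp (hmul (hfst hpos) (hsnd computable_den))
      (hmul (hsnd hneg) (hfst computable_den)))
    (Primrec.nat_add.to_comp.comp (hmul (hsnd hpos) (hfst computable_den))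
      (hmul (hfst hneg) (hsnd computable_den)))) fun x => ?_
  exact decide_eq_decide.2 (lt_iff_toNat_lt x.1 x.2).symm

theorem computable_mem_Ioo {U : ℕ → ℚ × ℚ} (hU : Computable U) :
    Computable₂ fun (r : ℚ) (n : ℕ) => decide ((U n).1 < r) && decide (r < (U n).2) := by
  have hUn : Computable fun x : ℚ × ℕ => U x.2 := hU.comp Computable.snd
  exact Primrec.and.to_comp.comp
    (computable_lt.comp (Computable.fst.comp hUn) Computable.fst)
    (computable_lt.comp Computable.fst (Computable.snd.comp hUn))

end Rat

theorem decide_membership_of_rationals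
    (a b : ℝ) (hab : a ≤ b) (U V : ℕ → ℚ × ℚ) (hU : Computable U) (hV : Computable V)
    (A : Set ℝ) (hA : A = ⋃ n, Set.Ioo ((U n).1 : ℝ) ((U n).2 : ℝ))
    (B : Set ℝ) (hB : B = ⋃ n, Set.Ioo ((V n).1 : ℝ) ((V n).2 : ℝ))
    (hcover : ∀ r : ℚ, (r : ℝ) ∈ Set.Icc a b → (r : ℝ) ∈ A ∪ B)
    (hdisj : ∀ r : ℚ, (r : ℝ) ∈ Set.Icc a b → (r : ℝ) ∉ A ∩ B) :
    ∃ g : ℚ →. Bool, Partrec g ∧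
      ∀ r : ℚ, (r : ℝ) ∈ Set.Icc a b →
        (g r).Dom ∧ (g r = Part.some true ↔ (r : ℝ) ∈ A) := by
  have hu := Rat.computable_mem_Ioo hU
  have hv := Rat.computable_mem_Ioo hV
  set u : ℚ → ℕ → Bool := fun r n => decide ((U n).1 < r) && decide (r < (U n).2) with hu_def
  set v : ℚ → ℕ → Bool := fun r n => decide ((V n).1 < r) && decide (r < (V n).2) with hv_def
  have hAu (r : ℚ) : (r : ℝ) ∈ A ↔ ∃ n, u r n = true := by simp [hA, hu_def]
  have hBv (r : ℚ) : (r : ℝ) ∈ B ↔ ∃ n, v r n = true := by simp [hB, hv_def]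
  have huv : Computable₂ fun r n => u r n || v r n := Primrec.or.to_comp.comp hu hv
  refine ⟨fun r => (Nat.rfind ((fun n => u r n || v r n : ℕ → Bool) : ℕ →. Bool)).map (u r),
    (Partrec.rfind huv.partrec.to₂).map hu, fun r hr => ?_⟩
  have hex : ∃ n, (u r n || v r n) = true := by
    rcases hcover r hr with h | h
    · obtain ⟨n, hn⟩ := (hAu r).1 h
      exact ⟨n, by simp [hn]⟩
    · obtain ⟨n, hn⟩ := (hBv r).1 h
      exact ⟨n, by simp [hn]⟩
  obtain ⟨n, hn⟩ := hex
  obtain ⟨m, hm, -⟩ := Nat.rfind_min' (p := fun n => u r n || v r n) hn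
  have hm_or : (u r m || v r m) = true := by simpa using (Nat.mem_rfind.1 hm).1
  have hg : (Nat.rfind ((fun n => u r n || v r n : ℕ → Bool) : ℕ →. Bool)).map (u r) = Part.some (u r m) :=
    Part.eq_some_iff.2 (Part.mem_map _ hm)
  beta_reduce
  rw [hg, Part.some_inj]
  refine ⟨trivial, ?_⟩
  refine ⟨fun h => (hAu r).2 ⟨m, h⟩, fun h => ?_⟩
  by_contra hum
  refine hdisj r hr ⟨h, (hBv r).2 ⟨m, ?_⟩⟩
  simpa [hum] using hm_or
end

section
/- Let A B : Set ℝ and let p₀ q₀ : ℚ with p₀ < q₀, (p₀ : ℝ) ∈ A, (q₀ : ℝ) ∈ B. Assume every rational r with p₀ ≤ r ≤ q₀ satisfies (r : ℝ) ∈ A ∪ B, and no rational r with p₀ ≤ r ≤ q₀ satisfies (r : ℝ) ∈ A ∩ B. Then there exist sequences p q : ℕ → ℚ with p 0 = p₀, q 0 = q₀, p monotone nondecreasing, q monotone nonincreasing, and for all n: p n < q n, q n - p n = (q₀ - p₀) / 2^n, (p n : ℝ) ∈ A, (q n : ℝ) ∈ B. Moreover there exists s ∈ Icc (p₀ : ℝ)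 (q₀ : ℝ) such that both (fun n => ((p n : ℝ))) and (fun n => ((q n : ℝ))) tend to s. -/
open Classical in
/-- Halve the interval `[x.1, x.2]`, keeping the right half if the midpoint lies in `S` and the
left half otherwise. -/
noncomputable def bisectStep (S : Set ℚ) (x : ℚ × ℚ) : ℚ × ℚ :=
  if (x.1 + x.2) / 2 ∈ S then ((x.1 + x.2) / 2, x.2) else (x.1, (x.1 + x.2) / 2)

theorem bisectStep_length (S : Set ℚ) (x : ℚ × ℚ) :
    (bisectStep S x).2 - (bisectStep S x).1 = (x.2 - x.1) / 2 := by
  unfold bisectStep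
  split_ifs <;> ring

theorem le_bisectStep_fst (S : Set ℚ) {x : ℚ × ℚ} (hx : x.1 ≤ x.2) :
    x.1 ≤ (bisectStep S x).1 := by
  unfold bisectStep
  split_ifs <;> linarith

theorem bisectStep_snd_le (S : Set ℚ) {x : ℚ × ℚ} (hx : x.1 ≤ x.2) :
    (bisectStep S x).2 ≤ x.2 := by
  unfold bisectStep
  split_ifs <;> linarith

theorem bisectStep_fst_mem {S : Set ℚ} {x : ℚ × ℚ} (hx : x.1 ∈ S) : (bisectStep S x).1 ∈ S := by
  unfold bisectStep
  split_ifs with h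
  exacts [h, hx]

theorem bisectStep_snd_mem {S T : Set ℚ} {x : ℚ × ℚ} (hx : x.2 ∈ T)
    (hmid : (x.1 + x.2) / 2 ∈ S ∪ T) : (bisectStep S x).2 ∈ T := by
  unfold bisectStep
  split_ifs with h
  exacts [hx, hmid.resolve_left h]

/-- Nested rational intervals whose lengths halve at each step shrink to a real point. -/
theorem exists_tendsto_of_halving {p q : ℕ → ℚ} (hp : Monotone p) (hq : Antitone q)
    (hlt : ∀ n, p n < q n) (hlen : ∀ n, q n - p n = (q 0 - p 0) / 2 ^ n) :
    ∃ s ∈ Set.Icc (p 0 : ℝ) (q 0 : ℝ),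
      Filter.Tendsto (fun n => (p n : ℝ)) Filter.atTop (nhds s) ∧
      Filter.Tendsto (fun n => (q n : ℝ)) Filter.atTop (nhds s) := by
  have hpR : Monotone fun n => (p n : ℝ) := Rat.cast_mono.comp hp
  have hle : ∀ n, (p n : ℝ) ≤ q 0 := fun n => by
    exact_mod_cast (hlt n).le.trans (hq n.zero_le)
  have hbdd : BddAbove (Set.range fun n => (p n : ℝ)) := ⟨q 0, by rintro _ ⟨n, rfl⟩; exact hle n⟩
  have hps := tendsto_atTop_ciSup hpR hbdd
  refine ⟨_, ⟨le_ciSup hbdd 0, ciSup_le hle⟩, hps, ?_⟩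
  have hgeom : Filter.Tendsto (fun n : ℕ => ((q 0 : ℝ) - p 0) * (1 / 2) ^ n) Filter.atTop
      (nhds 0) := by
    simpa using (tendsto_pow_atTop_nhds_zero_of_lt_one (r := (1 / 2 : ℝ)) (by norm_num)
      (by norm_num)).const_mul ((q 0 : ℝ) - p 0)
  have hsum := hps.add hgeom
  rw [add_zero] at hsum
  refine hsum.congr fun n => ?_
  have h : (q n : ℝ) - p n = (q 0 - p 0) / 2 ^ n := by exact_mod_cast hlen n
  rw [one_div, inv_pow, ← div_eq_mul_inv, ← h]
  ring

theorem bisection_between_A_and_B (A B : Set ℝ) (p₀ q₀ : ℚ) (hpq : p₀ < q₀)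
    (hp₀ : (p₀ : ℝ) ∈ A) (hq₀ : (q₀ : ℝ) ∈ B)
    (hcover : ∀ r : ℚ, p₀ ≤ r → r ≤ q₀ → (r : ℝ) ∈ A ∪ B)
    (hdisj : ∀ r : ℚ, p₀ ≤ r → r ≤ q₀ → (r : ℝ) ∉ A ∩ B) :
    ∃ p q : ℕ → ℚ, p 0 = p₀ ∧ q 0 = q₀ ∧ Monotone p ∧ Antitone q ∧
      (∀ n, p n < q n) ∧ (∀ n, q n - p n = (q₀ - p₀) / 2 ^ n) ∧
      (∀ n, (p n : ℝ) ∈ A) ∧ (∀ n, (q n : ℝ) ∈ B) ∧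
      ∃ s ∈ Set.Icc (p₀ : ℝ) (q₀ : ℝ),
        Filter.Tendsto (fun n => ((p n : ℝ))) Filter.atTop (nhds s) ∧
        Filter.Tendsto (fun n => ((q n : ℝ))) Filter.atTop (nhds s) := by
  let S : Set ℚ := {r | (r : ℝ) ∈ A}
  let T : Set ℚ := {r | (r : ℝ) ∈ B}
  let x : ℕ → ℚ × ℚ := fun n => (bisectStep S)^[n] (p₀, q₀)
  have hsucc : ∀ n, x (n + 1) = bisectStep S (x n) := fun n =>
    Function.iterate_succ_apply' _ _ _
  have hlen : ∀ n, (x n).2 - (x n).1 = (q₀ - p₀) / 2 ^ n := by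
    intro n
    induction n with
    | zero => simp [x]
    | succ n ih => rw [hsucc, bisectStep_length, ih, pow_succ, div_div]
  have hlt : ∀ n, (x n).1 < (x n).2 := fun n => by
    have h : 0 < (q₀ - p₀) / 2 ^ n := div_pos (sub_pos.2 hpq) (by positivity)
    rw [← hlen n] at h
    exact sub_pos.1 h
  have hp : Monotone fun n => (x n).1 := monotone_nat_of_le_succ fun n => by
    rw [hsucc]
    exact le_bisectStep_fst S (hlt n).le
  have hq : Antitone fun n => (x n).2 := antitone_nat_of_succ_le fun n => by
    rw [hsucc]
    exact bisectStep_snd_le S (hlt n).le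
  have hA : ∀ n, (x n).1 ∈ S := by
    intro n
    induction n with
    | zero => exact hp₀
    | succ n ih => rw [hsucc]; exact bisectStep_fst_mem ih
  have hB : ∀ n, (x n).2 ∈ T := by
    intro n
    induction n with
    | zero => exact hq₀
    | succ n ih =>
      rw [hsucc]
      have h₁ : p₀ ≤ (x n).1 := hp n.zero_le
      have h₂ : (x n).2 ≤ q₀ := hq n.zero_le
      have h₃ := hlt n
      exact bisectStep_snd_mem ih (hcover _ (by linarith) (by linarith))
  exact ⟨fun n => (x n).1, fun n => (x n).2, rfl, rfl, hp, hq, hlt, hlen, hA, hB,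
    exists_tendsto_of_halving hp hq hlt hlen⟩
end
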